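/- The polygon phase P_N on ℝ^{2n} has the following symmetries for all x₁,…,x_N, a ∈ ℝ^{2n}: (translation) P_N(x₁+a,…,x_N+a) = P_N(x₁,…,x_N) - δ_N·2·a ∧ S_N(x₁,…,x_N), where δ_N = 1 if N is even and δ_N = 0 if N is odd; (reflection) P_N(-x₁,…,-x_N) = P_N(x₁,…,x_N); (cyclic invariance, N odd) P_N(x₂,x₃,…,x_N,x₁) = P_N(x₁,x₂,…,x_N); (anticyclic antisymmetry) P_N(x_N,x_{N-1},…,x₁) = -P_N(x₁,x₂,…,x_N). -/

import Mathlib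

open Matrix MeasureTheory

noncomputable section

abbrev Vec (n : ℕ) := Fin (2*n) → ℝ

/-- The `2n×2n` symplectic matrix `J = [[0, Iₙ], [-Iₙ, 0]]`. -/
def symJ (n : ℕ) : Matrix (Fin (2*n)) (Fin (2*n)) ℝ :=
  Matrix.of fun i j =>
    if i.val < n ∧ j.val = i.val + n then 1
    else if j.val < n ∧ i.val = j.val + n then -1 else 0

/-- Gradient of a scalar function on `ℝ^m`, as the vector of partial derivatives. -/
def grad {m : ℕ} (f : (Fin m → ℝ) → ℝ) (x : Fin m → ℝ) : Fin m → ℝ :=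
  fun i => fderiv ℝ f x (Pi.single i 1)

/-- Primary Poisson bracket `{f,g}₁(x) = ∇f(x) · J ∇g(x)`. -/
def pb1 (n : ℕ) (f g : Vec n → ℝ) (x : Vec n) : ℝ :=
  grad f x ⬝ᵥ (symJ n).mulVec (grad g x)

/-- `x`-gradient of a function on secondary phase space `ℝ^{2n} × ℝ^{2n}`. -/
def grad2x (n : ℕ) (F : Vec n × Vec n → ℝ) (z : Vec n × Vec n) : Vec n :=
  fun i => fderiv ℝ F z (Pi.single i 1, 0)

/-- `y`-gradient of a function on secondary phase space `ℝ^{2n} × ℝ^{2n}`. -/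
def grad2y (n : ℕ) (F : Vec n × Vec n → ℝ) (z : Vec n × Vec n) : Vec n :=
  fun i => fderiv ℝ F z (0, Pi.single i 1)

/-- Secondary Poisson bracket `{F,G}₂(z) = ∇F(z) · J̃ ∇G(z)` with
`J̃ = [[0, I_{2n}], [-I_{2n}, 0]]`, i.e. `∇ₓF·∇_yG - ∇_yF·∇ₓG`. -/
def pb2 (n : ℕ) (F G : Vec n × Vec n → ℝ) (z : Vec n × Vec n) : ℝ :=
  grad2x n F z ⬝ᵥ grad2y n G z - grad2y n F z ⬝ᵥ grad2x n G z

/-- Left projection `l(x,y) = x - (1/2) J y`. -/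
def lmap (n : ℕ) (z : Vec n × Vec n) : Vec n := z.1 - (1/2 : ℝ) • (symJ n).mulVec z.2

/-- Right projection `r(x,y) = x + (1/2) J y`. -/
def rmap (n : ℕ) (z : Vec n × Vec n) : Vec n := z.1 + (1/2 : ℝ) • (symJ n).mulVec z.2

/-- Hessian matrix of a scalar function on `ℝ^m`. -/
def hess {m : ℕ} (f : (Fin m → ℝ) → ℝ) (x : Fin m → ℝ) : Matrix (Fin m) (Fin m) ℝ :=
  Matrix.of fun i j => fderiv ℝ (fun y => fderiv ℝ f y (Pi.single j 1)) x (Pi.single i 1)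

/-- Jacobian matrix of a map `ℝ^m → ℝ^m`. -/
def jac {m : ℕ} (f : (Fin m → ℝ) → (Fin m → ℝ)) (x : Fin m → ℝ) :
    Matrix (Fin m) (Fin m) ℝ :=
  Matrix.of fun i j => fderiv ℝ f x (Pi.single j 1) i

/-- Operator norm of a matrix acting on Euclidean space `ℝ^m`. -/
def opNorm {m : ℕ} (A : Matrix (Fin m) (Fin m) ℝ) : ℝ :=
  ‖Matrix.toEuclideanCLM (𝕜 := ℝ) A‖

/-- Symplectic pairing `x ∧ y = x · J y`. -/
def wedgeP (n : ℕ) (x y : Vec n) : ℝ := x ⬝ᵥ (symJ n).mulVec y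

/-- The polygon phase `P_N(x₁,…,x_N) = 2 Σ_{i<j} (-1)^{i+j+1} x_i ∧ x_j`
(indices here are 0-based; the signs agree with the 1-based convention). -/
def Psum (n : ℕ) (N : ℕ) (x : Fin N → Vec n) : ℝ :=
  2 * ∑ i : Fin N, ∑ j : Fin N,
    if (i : ℕ) < (j : ℕ) then (-1 : ℝ) ^ ((i : ℕ) + (j : ℕ) + 1) * wedgeP n (x i) (x j) else 0

/-- The alternating sum `S_N(x₁,…,x_N) = x₁ - x₂ + ⋯ + (-1)^{N+1} x_N` (0-based indices). -/
def Ssum (n : ℕ) (N : ℕ) (x : Fin N → Vec n) : Vec n :=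
  ∑ i : Fin N, ((-1 : ℝ) ^ (i : ℕ)) • x i

theorem symJ_transpose (n : ℕ) : (symJ n)ᵀ = -symJ n := by
  ext i j
  simp only [symJ, Matrix.transpose_apply, Matrix.of_apply, Matrix.neg_apply]
  split_ifs <;> first | omega | norm_num

theorem wedgeP_swap (n : ℕ) (x y : Vec n) : wedgeP n x y = - wedgeP n y x := by
  unfold wedgeP
  rw [Matrix.dotProduct_mulVec, ← Matrix.mulVec_transpose, symJ_transpose, dotProduct_comm,
    Matrix.neg_mulVec, dotProduct_neg]

theorem wedgeP_self (n : ℕ) (x : Vec n) : wedgeP n x x = 0 := by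
  have := wedgeP_swap n x x
  linarith

theorem wedgeP_add_left (n : ℕ) (x y z : Vec n) :
    wedgeP n (x + y) z = wedgeP n x z + wedgeP n y z := by
  simp [wedgeP, add_dotProduct]

theorem wedgeP_add_right (n : ℕ) (x y z : Vec n) :
    wedgeP n x (y + z) = wedgeP n x y + wedgeP n x z := by
  simp [wedgeP, Matrix.mulVec_add, dotProduct_add]

theorem wedgeP_smul_left (n : ℕ) (c : ℝ) (x z : Vec n) :
    wedgeP n (c • x) z = c * wedgeP n x z := by
  simp [wedgeP]

theorem wedgeP_smul_right (n : ℕ) (c : ℝ) (x z : Vec n) :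
    wedgeP n x (c • z) = c * wedgeP n x z := by
  rw [wedgeP_swap, wedgeP_smul_left, wedgeP_swap n x z]; ring

theorem wedgeP_Ssum_left (n N : ℕ) (x : Fin N → Vec n) (z : Vec n) :
    wedgeP n (Ssum n N x) z = ∑ i : Fin N, (-1 : ℝ) ^ (i : ℕ) * wedgeP n (x i) z := by
  simp [wedgeP, Ssum, sum_dotProduct]

theorem wedgeP_Ssum_right (n N : ℕ) (x : Fin N → Vec n) (z : Vec n) :
    wedgeP n z (Ssum n N x) = ∑ i : Fin N, (-1 : ℝ) ^ (i : ℕ) * wedgeP n z (x i) := by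
  rw [wedgeP_swap, wedgeP_Ssum_left, ← Finset.sum_neg_distrib]
  refine Finset.sum_congr rfl fun i _ => ?_
  rw [wedgeP_swap n z]; ring

theorem Psum_castSucc (n N : ℕ) (x : Fin (N + 1) → Vec n) :
    Psum n (N + 1) x = Psum n N (fun i => x i.castSucc) +
      2 * (-1) ^ (N + 1) * wedgeP n (Ssum n N (fun i => x i.castSucc)) (x (Fin.last N)) := by
  have h : ∀ i : Fin N, ¬ (N < (i : ℕ)) := fun i => by omega
  rw [wedgeP_Ssum_left]
  simp only [Psum, Fin.sum_univ_castSucc, Fin.val_castSucc, Fin.val_last, Fin.is_lt, if_true,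
    lt_irrefl, if_false, h, Finset.sum_const_zero, add_zero, Finset.sum_add_distrib, mul_add,
    Finset.mul_sum]
  congr 1
  refine Finset.sum_congr rfl fun i _ => ?_
  ring

theorem Psum_succ (n N : ℕ) (x : Fin (N + 1) → Vec n) :
    Psum n (N + 1) x = Psum n N (fun i => x i.succ) +
      2 * wedgeP n (x 0) (Ssum n N (fun i => x i.succ)) := by
  rw [wedgeP_Ssum_right]
  simp only [Psum, Fin.sum_univ_succ, Fin.val_succ, Fin.val_zero, Nat.succ_pos, if_true,
    lt_irrefl, if_false, Nat.not_lt_zero, zero_add, add_lt_add_iff_right]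
  rw [mul_add, add_comm]
  congr 1
  · congr 1
    refine Finset.sum_congr rfl fun i _ => Finset.sum_congr rfl fun j _ => ?_
    split_ifs
    · ring
    · rfl
  · congr 1
    refine Finset.sum_congr rfl fun i _ => ?_
    ring

theorem Ssum_castSucc (n N : ℕ) (x : Fin (N + 1) → Vec n) :
    Ssum n (N + 1) x = Ssum n N (fun i => x i.castSucc) + (-1 : ℝ) ^ N • x (Fin.last N) := by
  simp [Ssum, Fin.sum_univ_castSucc]

theorem Ssum_translate (n N : ℕ) (x : Fin N → Vec n) (a : Vec n) :
    Ssum n N (fun i => x i + a) = Ssum n N x + (if Even N then (0 : ℝ) else 1) • a := by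
  induction N with
  | zero => simp [Ssum]
  | succ N ih =>
    rw [Ssum_castSucc, Ssum_castSucc, ih]
    rcases Nat.even_or_odd N with h | h
    · simp [h, Nat.even_add_one, h.neg_one_pow, add_assoc]
    · have h' := Nat.not_even_iff_odd.2 h
      simp [h', Nat.even_add_one, h.neg_one_pow]
      abel

theorem Psum_translate (n N : ℕ) (x : Fin N → Vec n) (a : Vec n) :
    Psum n N (fun i => x i + a) =
      Psum n N x - (if Even N then (1 : ℝ) else 0) * (2 * wedgeP n a (Ssum n N x)) := by
  induction N with
  | zero => simp [Psum, Ssum, wedgeP]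
  | succ N ih =>
    rw [Psum_castSucc, ih, Ssum_translate, Psum_castSucc n N x, Ssum_castSucc]
    simp only [wedgeP_add_left, wedgeP_add_right, wedgeP_smul_left, wedgeP_smul_right,
      wedgeP_self]
    rw [wedgeP_swap n a (Ssum _ _ _)]
    rcases Nat.even_or_odd N with h | h
    · simp only [h, Nat.even_add_one, pow_succ, h.neg_one_pow, if_true, if_false, not_true]
      ring
    · have h' := Nat.not_even_iff_odd.2 h
      simp only [h', Nat.even_add_one, pow_succ, h.neg_one_pow, if_true, if_false, not_false_iff]
      ring

theorem Ssum_rev (n N : ℕ) (x : Fin N → Vec n) :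
    Ssum n N (fun i => x i.rev) = (-1 : ℝ) ^ (N + 1) • Ssum n N x := by
  unfold Ssum
  rw [← Equiv.sum_comp Fin.revPerm, Finset.smul_sum]
  refine Finset.sum_congr rfl fun i _ => ?_
  simp only [Fin.revPerm_apply, Fin.rev_rev]
  rw [smul_smul, ← pow_add]
  congr 1
  rw [Fin.val_rev]
  have : N + 1 + (i : ℕ) = (N - (i + 1)) + 2 * (i + 1) := by omega
  rw [this, pow_add, pow_mul]
  simp

theorem Psum_rev (n N : ℕ) (x : Fin N → Vec n) :
    Psum n N (fun i => x i.rev) = - Psum n N x := by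
  induction N with
  | zero => simp [Psum]
  | succ N ih =>
    rw [Psum_castSucc, Psum_succ]
    simp only [Fin.rev_castSucc, Fin.rev_last]
    rw [ih (fun i => x i.succ), Ssum_rev n N (fun i => x i.succ), wedgeP_smul_left,
      wedgeP_swap n (x 0)]
    have : ((-1 : ℝ) ^ (N + 1)) * (-1) ^ (N + 1) = 1 := by
      rw [← mul_pow]; simp
    linear_combination 2 * wedgeP n (Ssum n N fun i => x i.succ) (x 0) * this

/-- symmetries of the polygon phase: translation
`P_N(x+a) = P_N(x) - δ_N·2·a∧S_N(x)`, reflection `P_N(-x) = P_N(x)`, cyclic invariance for odd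
`N`, and anticyclic antisymmetry `P_N(x_N,…,x₁) = -P_N(x₁,…,x_N)`. -/
theorem stmt15 (n : ℕ) (N : ℕ) (x : Fin N → Vec n) (a : Vec n) :
    (Psum n N (fun i => x i + a) =
      Psum n N x - (if Even N then (1 : ℝ) else 0) * (2 * wedgeP n a (Ssum n N x))) ∧
    (Psum n N (fun i => -(x i)) = Psum n N x) ∧
    (Odd N → Psum n N (fun i => x (finRotate N i)) = Psum n N x) ∧
    (Psum n N (fun i => x i.rev) = -Psum n N x) := by
  refine ⟨Psum_translate n N x a, ?_, ?_, Psum_rev n N x⟩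
  · simp [Psum, wedgeP, Matrix.mulVec_neg]
  · intro h
    cases N with
    | zero => simp at h
    | succ N =>
      have hp : (-1 : ℝ) ^ (N + 1) = -1 := h.neg_one_pow
      rw [Psum_castSucc, Psum_succ, hp]
      simp only [finRotate_last, finRotate_succ_apply, Fin.coeSucc_eq_succ, Fin.last_add_one]
      rw [wedgeP_swap n (x 0)]
      ring
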